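/- Let ε, θ, N be real numbers with 0 < ε ≤ 1/4, 0 < θ ≤ 1, and N ≥ 1, and set t* = log(N/θ)/(100·ε²). Then (N/2) · (1 − 4ε²)^{4t*} · (1 − 2ε)^{(2/(10ε))·log(N/θ)} ≥ θ/2, where the powers are real powers and log is the natural logarithm. -/

import Mathlib

/-- A linear lower bound for `log (1 - y)` on `[0, 1/2]`. -/
theorem neg_three_halves_mul_le_log_one_sub {y : ℝ} (hy0 : 0 ≤ y) (hy1 : y ≤ 1 / 2) :
    -(3 / 2 * y) ≤ Real.log (1 - y) := by
  have hpos : 0 < 1 - y := by linarith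
  rw [Real.le_log_iff_exp_le hpos, Real.exp_neg]
  have hexp := Real.quadratic_le_exp_of_nonneg (x := 3 / 2 * y) (by positivity)
  rw [inv_le_iff_one_le_mul₀ (Real.exp_pos _)]
  have hmul := mul_le_mul_of_nonneg_left hexp hpos.le
  have hfactor : 0 ≤ y * ((1 / 2 - y) * (15 / 16 + 9 / 8 * y) + 1 / 32) := by
    have : 0 ≤ 1 / 2 - y := by linarith
    positivity
  linarith

/-- Combined key inequality in the bandit lower bound proof (Theorem A.2),
with `c = 100` and `d = 1.78`: for `0 < ε ≤ 1/4`, `0 < θ ≤ 1`, `N ≥ 1` and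
`t* = log(N/θ)/(100ε²)`,
`(N/2)·(1 − 4ε²)^{4t*}·(1 − 2ε)^{(2/(10ε))·log(N/θ)} ≥ θ/2`. -/
theorem combined_key_inequality
    (ε θ N : ℝ) (hε0 : 0 < ε) (hε1 : ε ≤ 1 / 4)
    (hθ0 : 0 < θ) (hθ1 : θ ≤ 1) (hN : 1 ≤ N) :
    (N / 2) * (1 - 4 * ε ^ 2) ^ (4 * (Real.log (N / θ) / (100 * ε ^ 2))) *
        (1 - 2 * ε) ^ ((2 / (10 * ε)) * Real.log (N / θ)) ≥ θ / 2 := by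
  have hNθ : 1 ≤ N / θ := (one_le_div hθ0).2 (by linarith)
  have hL : 0 ≤ Real.log (N / θ) := Real.log_nonneg hNθ
  have hpos₁ : 0 < 1 - 4 * ε ^ 2 := by nlinarith
  have hpos₂ : 0 < 1 - 2 * ε := by linarith
  have hlog₁ := neg_three_halves_mul_le_log_one_sub (y := 4 * ε ^ 2) (by positivity) (by nlinarith)
  have hlog₂ := neg_three_halves_mul_le_log_one_sub (y := 2 * ε) (by positivity) (by linarith)
  have hexp : θ / N ≤ (1 - 4 * ε ^ 2) ^ (4 * (Real.log (N / θ) / (100 * ε ^ 2))) *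
      (1 - 2 * ε) ^ ((2 / (10 * ε)) * Real.log (N / θ)) := by
    rw [Real.rpow_def_of_pos hpos₁, Real.rpow_def_of_pos hpos₂, ← Real.exp_add,
      ← Real.log_le_iff_le_exp (by positivity), ← inv_div, Real.log_inv]
    generalize Real.log (N / θ) = L at hL ⊢
    have h₁ := mul_le_mul_of_nonneg_right hlog₁
      (show 0 ≤ 4 * (L / (100 * ε ^ 2)) by positivity)
    have h₂ := mul_le_mul_of_nonneg_right hlog₂ (show 0 ≤ 2 / (10 * ε) * L by positivity)
    have e₁ : -(3 / 2 * (4 * ε ^ 2)) * (4 * (L / (100 * ε ^ 2))) = -(6 / 25) * L := by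
      field_simp
      ring
    have e₂ : -(3 / 2 * (2 * ε)) * (2 / (10 * ε) * L) = -(3 / 5) * L := by
      field_simp
      ring
    linarith
  calc θ / 2 = N / 2 * (θ / N) := by field_simp
    _ ≤ _ := by
      rw [mul_assoc]
      gcongr
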